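/- With ξ₀, μ₁, μ₂ and ζ¹(τ,θ) as above, and P(τξ) = |τξ|² - 2iζ¹(τ,θ)·τξ, define z₁(τ,θ) = Re P(τξ)/τ² and z₂(τ,θ) = Im P(τξ)/τ² as functions of (τ,θ) for fixed ξ ∈ ℝ^d. Then for 0 < τ ≤ min(1, 1/(2|ξ₀|)), the absolute value J of the Jacobian determinant of (τ,θ) ↦ (z₁, z₂) satisfies J ≥ 2|ξ^⊥|²/τ³, where ξ^⊥ is the orthogonal projection of ξ onto span{μ₁, μ₂}. -/

import Mathlib

open Matrix
open scoped RealInnerProductSpace BigOperators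

/-- lower bound for the Jacobian of (τ,θ) ↦ (Re P(τξ)/τ², Im P(τξ)/τ²),
where P(τξ) = |τξ|² - 2iζ¹(τ,θ)·τξ: for 0 < τ ≤ min(1, 1/(2|ξ₀|)),
|J| ≥ 2|ξ^⊥|²/τ³ with ξ^⊥ the projection of ξ onto span{μ₁, μ₂}. -/
theorem jacobian_lower_bound (d : ℕ) (ξ₀ μ₁ μ₂ : EuclideanSpace ℝ (Fin d))
    (hξ₀ : ξ₀ ≠ 0)
    (h₁₁ : ⟪μ₁, μ₁⟫ = 1) (h₂₂ : ⟪μ₂, μ₂⟫ = 1) (h₁₂ : ⟪μ₁, μ₂⟫ = 0)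
    (ho₁ : ⟪ξ₀, μ₁⟫ = 0) (ho₂ : ⟪ξ₀, μ₂⟫ = 0)
    (ξ : EuclideanSpace ℝ (Fin d))
    (τ θ : ℝ) (hτ0 : 0 < τ) (hτ : τ ≤ min 1 (1 / (2 * ‖ξ₀‖))) :
    let zeta1 : ℝ → ℝ → Fin d → ℂ := fun t a i =>
      ((μ₁ i * Real.cos a - μ₂ i * Real.sin a : ℝ) : ℂ)
      + Complex.I * ((Real.sqrt (1 - t ^ 2 * ‖ξ₀‖ ^ 2 / 4) *
          (μ₁ i * Real.sin a + μ₂ i * Real.cos a) : ℝ) : ℂ)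
      - Complex.I * ((t * ξ₀ i / 2 : ℝ) : ℂ)
    let Pτ : ℝ → ℝ → ℂ := fun t a =>
      ((‖t • ξ‖ ^ 2 : ℝ) : ℂ) - 2 * Complex.I * ∑ i, zeta1 t a i * ((t * ξ i : ℝ) : ℂ)
    let z₁ : ℝ → ℝ → ℝ := fun t a => (Pτ t a).re / t ^ 2
    let z₂ : ℝ → ℝ → ℝ := fun t a => (Pτ t a).im / t ^ 2
    2 * ((⟪ξ, μ₁⟫ ^ 2 + ⟪ξ, μ₂⟫ ^ 2) / τ ^ 3) ≤
      |Matrix.det !![deriv (fun t => z₁ t θ) τ, deriv (fun a => z₁ τ a) θ;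
                     deriv (fun t => z₂ t θ) τ, deriv (fun a => z₂ τ a) θ]| := by
  intro zeta1 Pτ z₁ z₂
  have hk : τ ^ 2 * ‖ξ₀‖ ^ 2 ≤ 1 / 4 := by
    have hn : 0 < ‖ξ₀‖ := norm_pos_iff.mpr hξ₀
    have h := hτ.trans (min_le_right _ _)
    rw [le_div_iff₀ (by positivity)] at h
    have h2 : τ * ‖ξ₀‖ ≤ 1 / 2 := by linarith
    have h3 : 0 ≤ τ * ‖ξ₀‖ := by positivity
    nlinarith
  have hi : ∀ u v : EuclideanSpace ℝ (Fin d), ⟪u, v⟫ = ∑ i, v i * u i := by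
    intro u v
    simp [PiLp.inner_apply]
  obtain ⟨p, hp⟩ : ∃ p, p = ⟪ξ, μ₁⟫ := ⟨_, rfl⟩
  obtain ⟨q, hq⟩ : ∃ q, q = ⟪ξ, μ₂⟫ := ⟨_, rfl⟩
  obtain ⟨c, hc⟩ : ∃ c, c = ⟪ξ, ξ₀⟫ := ⟨_, rfl⟩
  have hz₁ : ∀ t a, z₁ t a = (t ^ 2 * ‖ξ‖ ^ 2 + 2 * t * (Real.sqrt (1 - t ^ 2 * ‖ξ₀‖ ^ 2 / 4) *
      (p * Real.sin a + q * Real.cos a)) - t ^ 2 * c) / t ^ 2 := by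
    intro t a
    have hre : (∑ i, zeta1 t a i * ((t * ξ i : ℝ) : ℂ)).im
        = t * (Real.sqrt (1 - t ^ 2 * ‖ξ₀‖ ^ 2 / 4) *
      (p * Real.sin a + q * Real.cos a)) - t ^ 2 * c / 2 := by
      rw [hp, hq, hc, hi, hi, hi, Complex.im_sum]
      simp only [Finset.mul_sum, Finset.sum_mul, Finset.sum_div, ← Finset.sum_add_distrib,
        ← Finset.sum_sub_distrib]
      refine Finset.sum_congr rfl fun i _ => ?_
      simp only [zeta1, Complex.mul_im, Complex.add_im, Complex.sub_im, Complex.add_re,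
        Complex.sub_re, Complex.mul_re, Complex.I_re, Complex.I_im, Complex.ofReal_re,
        Complex.ofReal_im]
      ring
    simp only [z₁, Pτ]
    congr 1
    simp only [Complex.sub_re, Complex.mul_re, Complex.mul_im, Complex.ofReal_re, Complex.I_re,
      Complex.I_im, Complex.re_ofNat, Complex.im_ofNat, hre, norm_smul, Real.norm_eq_abs, mul_pow,
      sq_abs]
    ring
  have hz₂ : ∀ t a, z₂ t a = (-2 * t * (p * Real.cos a - q * Real.sin a)) / t ^ 2 := by
    intro t a
    have hre : (∑ i, zeta1 t a i * ((t * ξ i : ℝ) : ℂ)).re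
        = t * (p * Real.cos a - q * Real.sin a) := by
      rw [hp, hq, hi, hi, Complex.re_sum]
      simp only [Finset.mul_sum, Finset.sum_mul, ← Finset.sum_sub_distrib]
      refine Finset.sum_congr rfl fun i _ => ?_
      simp only [zeta1, Complex.mul_im, Complex.add_im, Complex.sub_im, Complex.add_re,
        Complex.sub_re, Complex.mul_re, Complex.I_re, Complex.I_im, Complex.ofReal_re,
        Complex.ofReal_im]
      ring
    simp only [z₂, Pτ]
    congr 1
    simp only [Complex.sub_im, Complex.mul_re, Complex.mul_im, Complex.ofReal_im, Complex.I_re,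
      Complex.I_im, Complex.re_ofNat, Complex.im_ofNat, hre]
    ring
  obtain ⟨s, hs⟩ : ∃ s, s = Real.sqrt (1 - τ ^ 2 * ‖ξ₀‖ ^ 2 / 4) := ⟨_, rfl⟩
  have hs2 : s ^ 2 = 1 - τ ^ 2 * ‖ξ₀‖ ^ 2 / 4 := by
    rw [hs, Real.sq_sqrt (by linarith)]
  have hs0 : 0 ≤ s := hs ▸ Real.sqrt_nonneg _
  have hsl : 1 / 2 ≤ s := by nlinarith
  have hsu : s ≤ 1 := by nlinarith [sq_nonneg (τ * ‖ξ₀‖)]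
  have hspos : 0 < s := by linarith
  obtain ⟨A, hA⟩ : ∃ A, A = p * Real.cos θ - q * Real.sin θ := ⟨_, rfl⟩
  obtain ⟨B, hB⟩ : ∃ B, B = p * Real.sin θ + q * Real.cos θ := ⟨_, rfl⟩
  have hsq : HasDerivAt (fun t : ℝ => Real.sqrt (1 - t ^ 2 * ‖ξ₀‖ ^ 2 / 4))
      (-(2 * τ * ‖ξ₀‖ ^ 2 / 4) / (2 * s)) τ := by
    have h : HasDerivAt (fun t : ℝ => 1 - t ^ 2 * ‖ξ₀‖ ^ 2 / 4) (-(2 * τ * ‖ξ₀‖ ^ 2 / 4)) τ := by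
      have := (((hasDerivAt_pow 2 τ).mul_const (‖ξ₀‖ ^ 2)).div_const 4).const_sub 1
      simpa using this
    rw [hs]
    exact h.sqrt (by linarith)
  have hτne : τ ^ 2 ≠ 0 := by positivity
  have d11 : deriv (fun t => z₁ t θ) τ = -2 * B / (s * τ ^ 2) := by
    simp only [hz₁, ← hB]
    have h2 := hasDerivAt_pow 2 τ
    have h := ((((h2.mul_const (‖ξ‖ ^ 2)).add
      (((hasDerivAt_id τ).const_mul 2).mul (hsq.mul_const B))).sub (h2.mul_const c)).div h2 hτne)
    refine HasDerivAt.deriv (h.congr_deriv ?_)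
    simp only [Pi.add_apply, Pi.sub_apply, Pi.mul_apply, id, ← hs]
    have hk2 : ‖ξ₀‖ ^ 2 = 4 * (1 - s ^ 2) / τ ^ 2 := by
      rw [hs2]; field_simp; ring
    rw [hk2]
    field_simp
    ring
  have d12 : deriv (fun a => z₁ τ a) θ = 2 * s * A / τ := by
    simp only [hz₁, ← hs]
    have h := (((((((Real.hasDerivAt_sin θ).const_mul p).add
      ((Real.hasDerivAt_cos θ).const_mul q)).const_mul s).const_mul (2 * τ)).const_add
        (τ ^ 2 * ‖ξ‖ ^ 2)).sub_const (τ ^ 2 * c)).div_const (τ ^ 2)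
    refine HasDerivAt.deriv (h.congr_deriv ?_)
    rw [hA]
    field_simp
    ring
  have d21 : deriv (fun t => z₂ t θ) τ = 2 * A / τ ^ 2 := by
    simp only [hz₂, ← hA]
    have h := ((((hasDerivAt_id τ).const_mul (-2)).mul_const A).div (hasDerivAt_pow 2 τ) hτne)
    refine HasDerivAt.deriv (h.congr_deriv ?_)
    simp only [id]
    field_simp
    ring
  have d22 : deriv (fun a => z₂ τ a) θ = 2 * B / τ := by
    simp only [hz₂]
    have h := ((((Real.hasDerivAt_cos θ).const_mul p).sub
      ((Real.hasDerivAt_sin θ).const_mul q)).const_mul (-2 * τ)).div_const (τ ^ 2)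
    refine HasDerivAt.deriv (h.congr_deriv ?_)
    rw [hB]
    field_simp
    ring
  rw [d11, d12, d21, d22, Matrix.det_fin_two_of, ← hp, ← hq]
  have hAB : p ^ 2 + q ^ 2 = A ^ 2 + B ^ 2 := by
    rw [hA, hB]
    linear_combination (-(p ^ 2 + q ^ 2)) * Real.sin_sq_add_cos_sq θ
  have hdet : -2 * B / (s * τ ^ 2) * (2 * B / τ) - 2 * s * A / τ * (2 * A / τ ^ 2)
      = -((4 * (B ^ 2 / s) + 4 * s * A ^ 2) / τ ^ 3) := by
    field_simp
    ring
  rw [hdet, abs_neg, hAB, ← mul_div_assoc]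
  refine le_trans ?_ (le_abs_self _)
  have hBs : B ^ 2 ≤ B ^ 2 / s := by
    rw [le_div_iff₀ hspos]
    nlinarith [sq_nonneg B]
  gcongr
  nlinarith [sq_nonneg A, sq_nonneg B]
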